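/- For every guarded map f : X → Q̂(Y ⊕ X), ρ ∘ f† = ρ ∘ (υ ∘ ρ ∘ f)†, where (−)† denotes the unique guarded fixpoint operator of Q̂ (note that υ ∘ ρ ∘ f is again guarded). -/

import Mathlib

set_option autoImplicit false

open scoped NNReal ENNReal

/-! ### The duration monad `Q` -/

/-- The duration monad: `Q X = ([0,∞) × X) ⊕ [0,∞]`. -/
abbrev Q (X : Type) : Type := (ℝ≥0 × X) ⊕ ℝ≥0∞

/-- Unit of `Q` : `η x = (0, x)`. -/
def Q.eta {X : Type} (x : X) : Q X := Sum.inl (0, x)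

/-- Kleisli lifting of `Q`. -/
noncomputable def Q.bind {X Y : Type} (f : X → Q Y) : Q X → Q Y
  | Sum.inl (d, x) =>
      match f x with
      | Sum.inl (e, y) => Sum.inl (d + e, y)
      | Sum.inr c => Sum.inr ((d : ℝ≥0∞) + c)
  | Sum.inr c => Sum.inr c

/-- Functorial action of `Q`. -/
def Q.map {X Y : Type} (h : X → Y) : Q X → Q Y
  | Sum.inl (d, x) => Sum.inl (d, h x)
  | Sum.inr c => Sum.inr c

/-- Strength of `Q`. -/
def Q.tau {Z X : Type} : Z × Q X → Q (Z × X)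
  | (z, Sum.inl (d, x)) => Sum.inl (d, (z, x))
  | (_, Sum.inr c) => Sum.inr c

/-! ### The layered duration monad `Q̂` -/

/-- The layered duration monad: `Q̂ X = (W × X) ⊕ S`, where `W` is the set of
finite words over `[0,∞)` and `S` is the set of infinite streams over
`[0,∞)`. -/
abbrev QHat (X : Type) : Type := (List ℝ≥0 × X) ⊕ (ℕ → ℝ≥0)

/-- Unit of `Q̂` : `η̂ x = (ε, x)`. -/
def QHat.eta {X : Type} (x : X) : QHat X := Sum.inl ([], x)

/-- The stream obtained by prefixing the stream `s` with the finite word `w`. -/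
def prefixStream (w : List ℝ≥0) (s : ℕ → ℝ≥0) : ℕ → ℝ≥0 := fun k =>
  if h : k < w.length then w.get ⟨k, h⟩ else s (k - w.length)

/-- Kleisli lifting of `Q̂`. -/
def QHat.bind {X Y : Type} (f : X → QHat Y) : QHat X → QHat Y
  | Sum.inl (w, x) =>
      match f x with
      | Sum.inl (u, y) => Sum.inl (w ++ u, y)
      | Sum.inr s => Sum.inr (prefixStream w s)
  | Sum.inr s => Sum.inr s

/-- A map `f : X → Q̂ (Y ⊕ X)` is guarded if whenever `f x = (w, inr z)`, the
word `w` is non-empty. -/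
def QHat.Guarded {X Y : Type} (f : X → QHat (Y ⊕ X)) : Prop :=
  ∀ (x : X) (w : List ℝ≥0) (z : X), f x = Sum.inl (w, Sum.inr z) → w ≠ []

/-- `g` solves the fixpoint equation `g = [η̂, g]* ∘ f` characterising the
iteration `f†` of `f`. -/
def QHat.IsDagger {X Y : Type} (f : X → QHat (Y ⊕ X)) (g : X → QHat Y) : Prop :=
  g = fun x => QHat.bind (Sum.elim QHat.eta g) (f x)

/-- The quotienting map `ρ : Q̂ X → Q X`, summing up words and streams of
durations. -/
noncomputable def QRho {X : Type} : QHat X → Q X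
  | Sum.inl (w, x) => Sum.inl (w.sum, x)
  | Sum.inr s => Sum.inr (∑' i : ℕ, (s i : ℝ≥0∞))

/-- The section `υ : Q X → Q̂ X` of `ρ`. -/
noncomputable def QUps {X : Type} : Q X → QHat X
  | Sum.inl (d, x) => Sum.inl ([d], x)
  | Sum.inr c =>
      if c = ⊤ then Sum.inr (fun _ => 1)
      else Sum.inr (fun k => if k = 0 then c.toNNReal else 0)

theorem prefixStream_nil (s : ℕ → ℝ≥0) : prefixStream [] s = s := by
  funext k; simp [prefixStream]

theorem prefixStream_cons_zero (a : ℝ≥0) (w : List ℝ≥0) (s : ℕ → ℝ≥0) :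
    prefixStream (a :: w) s 0 = a := by
  simp [prefixStream]

theorem prefixStream_cons_succ (a : ℝ≥0) (w : List ℝ≥0) (s : ℕ → ℝ≥0) (k : ℕ) :
    prefixStream (a :: w) s (k + 1) = prefixStream w s k := by
  simp [prefixStream]

theorem tsum_prefixStream (w : List ℝ≥0) (s : ℕ → ℝ≥0) :
    ∑' i, (prefixStream w s i : ℝ≥0∞) = (w.sum : ℝ≥0) + ∑' i, (s i : ℝ≥0∞) := by
  induction w with
  | nil => simp [prefixStream_nil]
  | cons a w ih =>
    rw [tsum_eq_zero_add' ENNReal.summable]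
    simp only [prefixStream_cons_zero, prefixStream_cons_succ, ih, List.sum_cons, ENNReal.coe_add,
      add_assoc]

theorem partial_prefixStream (w : List ℝ≥0) (s : ℕ → ℝ≥0) (n : ℕ) :
    ∑ i ∈ Finset.range n, (prefixStream w s i : ℝ≥0∞) ≤
      (w.sum : ℝ≥0) + ∑ i ∈ Finset.range n, (s i : ℝ≥0∞) := by
  induction w generalizing n with
  | nil => simp [prefixStream_nil]
  | cons a w ih =>
    cases n with
    | zero => simp
    | succ n =>
      rw [Finset.sum_range_succ']
      simp only [prefixStream_cons_zero, prefixStream_cons_succ, List.sum_cons, ENNReal.coe_add]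
      rw [add_comm, add_assoc]
      gcongr
      refine (ih n).trans ?_
      gcongr
      simp

theorem rho_ups {X : Type} (q : Q X) : QRho (QUps q) = q := by
  rcases q with ⟨d, x⟩ | c
  · simp [QUps, QRho]
  · by_cases hc : c = ⊤
    · simp [QUps, QRho, hc, ENNReal.tsum_const_eq_top_of_ne_zero]
    · simp only [QUps, QRho, hc, if_false]
      congr 1
      rw [tsum_eq_single 0]
      · simp [hc]
      · intro b hb
        simp [hb]

theorem dagger_finite {X Y : Type} (f₁ f₂ : X → QHat (Y ⊕ X))
    (hf₁ : QHat.Guarded f₁) (hr : ∀ x, QRho (f₁ x) = QRho (f₂ x))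
    (g₁ g₂ : X → QHat Y) (hg₁ : QHat.IsDagger f₁ g₁) (hg₂ : QHat.IsDagger f₂ g₂)
    (n : ℕ) : ∀ (x : X) (u : List ℝ≥0) (y : Y), u.length < n → g₁ x = Sum.inl (u, y) →
      QRho (g₂ x) = Sum.inl (u.sum, y) := by
  induction n with
  | zero => intro x u y h; simp at h
  | succ n ih =>
    intro x u y hn hx
    have e₁ := congrFun hg₁ x
    have e₂ := congrFun hg₂ x
    have hrx := hr x
    rcases h₁ : f₁ x with ⟨w, y' | z⟩ | s <;> rcases h₂ : f₂ x with ⟨w₂, y₂ | z₂⟩ | s₂ <;>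
      simp only [h₁, h₂, QRho, Sum.inl.injEq, Sum.inr.injEq, Prod.mk.injEq, reduceCtorEq,
        and_false] at hrx
    · simp only [h₁, h₂, QHat.bind, Sum.elim_inl, QHat.eta, List.append_nil] at e₁ e₂
      rw [e₂]
      rw [hx] at e₁
      simp only [Sum.inl.injEq, Prod.mk.injEq] at e₁
      simp [QRho, e₁.1, e₁.2, hrx.1, hrx.2]
    · obtain ⟨hw, rfl⟩ := hrx
      have hne := hf₁ x w z h₁
      simp only [h₁, h₂, QHat.bind, Sum.elim_inr] at e₁ e₂
      rcases hz : g₁ z with ⟨u', y'⟩ | s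
      · rw [hz, hx] at e₁
        simp only [Sum.inl.injEq, Prod.mk.injEq] at e₁
        obtain ⟨rfl, rfl⟩ := e₁
        have hl : u'.length < n := by
          have := List.length_pos_iff.2 hne
          simp at hn
          omega
        have := ih z u' y hl hz
        rcases hz₂ : g₂ z with ⟨u₂, y₂⟩ | s
        · rw [hz₂] at this e₂
          simp only [QRho, Sum.inl.injEq, Prod.mk.injEq] at this
          rw [e₂]
          simp [QRho, this.1, this.2, hw]
        · rw [hz₂] at this
          simp [QRho] at this
      · rw [hz, hx] at e₁
        simp at e₁
    · simp only [h₁, QHat.bind] at e₁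
      rw [hx] at e₁
      simp at e₁

theorem dagger_infinite {X Y : Type} (f₁ f₂ : X → QHat (Y ⊕ X))
    (hf₁ : QHat.Guarded f₁) (hr : ∀ x, QRho (f₁ x) = QRho (f₂ x))
    (g₁ g₂ : X → QHat Y) (hg₁ : QHat.IsDagger f₁ g₁) (hg₂ : QHat.IsDagger f₂ g₂)
    (n : ℕ) : ∀ (x : X) (s t : ℕ → ℝ≥0), g₁ x = Sum.inr s → g₂ x = Sum.inr t →
      ∑ i ∈ Finset.range n, (s i : ℝ≥0∞) ≤ ∑' i, (t i : ℝ≥0∞) := by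
  induction n with
  | zero => intros; simp
  | succ n ih =>
    intro x s t hx hx₂
    have e₁ := congrFun hg₁ x
    have e₂ := congrFun hg₂ x
    have hrx := hr x
    rcases h₁ : f₁ x with ⟨w, y' | z⟩ | s₁ <;> rcases h₂ : f₂ x with ⟨w₂, y₂ | z₂⟩ | s₂ <;>
      simp only [h₁, h₂, QRho, Sum.inl.injEq, Sum.inr.injEq, Prod.mk.injEq, reduceCtorEq,
        and_false] at hrx
    · simp only [h₁, QHat.bind, Sum.elim_inl, QHat.eta] at e₁
      rw [hx] at e₁
      simp at e₁
    · obtain ⟨hw, rfl⟩ := hrx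
      have hne := hf₁ x w z h₁
      simp only [h₁, h₂, QHat.bind, Sum.elim_inr] at e₁ e₂
      rcases hz : g₁ z with ⟨u', y'⟩ | s'
      · rw [hz, hx] at e₁
        simp at e₁
      rcases hz₂ : g₂ z with ⟨u', y'⟩ | t'
      · rw [hz₂, hx₂] at e₂
        simp at e₂
      rw [hz, hx] at e₁
      rw [hz₂, hx₂] at e₂
      simp only [Sum.inr.injEq] at e₁ e₂
      subst e₁ e₂
      rw [tsum_prefixStream, ← hw]
      cases w with
      | nil => exact absurd rfl hne
      | cons a w =>
        rw [Finset.sum_range_succ']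
        simp only [prefixStream_cons_zero, prefixStream_cons_succ, List.sum_cons,
          ENNReal.coe_add]
        rw [add_comm, add_assoc]
        gcongr
        refine (partial_prefixStream w s' n).trans ?_
        gcongr
        exact ih z s' t' hz hz₂
    · simp only [h₁, h₂, QHat.bind] at e₁ e₂
      rw [hx] at e₁
      rw [hx₂] at e₂
      simp only [Sum.inr.injEq] at e₁ e₂
      subst e₁ e₂
      rw [← hrx]
      exact ENNReal.sum_le_tsum _

theorem ups_guarded {X Y : Type} (f : X → QHat (Y ⊕ X)) :
    QHat.Guarded (fun x => QUps (QRho (f x))) := by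
  intro x w z h
  dsimp only at h
  generalize QRho (f x) = q at h
  rcases q with ⟨d, v⟩ | c
  · simp only [QUps, Sum.inl.injEq, Prod.mk.injEq] at h
    simp [← h.1]
  · simp only [QUps] at h
    split_ifs at h

/-- Theorem 4.5 (3): for any guarded `f : X → Q̂ (Y ⊕ X)`,
`ρ ∘ f† = ρ ∘ (υ ∘ ρ ∘ f)†`, where `(−)†` denotes the unique guarded fixpoint
operator of `Q̂` (here rendered via the characterising fixpoint equations of
the two daggers). -/
theorem rho_preserves_dagger {X Y : Type}
    (f : X → QHat (Y ⊕ X)) (hf : QHat.Guarded f)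
    (g h : X → QHat Y)
    (hg : QHat.IsDagger f g)
    (hh : QHat.IsDagger (fun x => QUps (QRho (f x))) h) :
    (fun x => QRho (g x)) = (fun x => QRho (h x)) := by
  have hf₂ := ups_guarded f
  have hr : ∀ x, QRho (f x) = QRho (QUps (QRho (f x))) := fun x => (rho_ups _).symm
  funext x
  rcases h₁ : g x with ⟨u, y⟩ | s
  · exact (dagger_finite f _ hf hr g h hg hh _ x u y (Nat.lt_succ_self _) h₁).symm
  · rcases h₂ : h x with ⟨u, y⟩ | t
    · rw [← h₁]
      exact dagger_finite _ f hf₂ (fun x => (hr x).symm) h g hh hg _ x u y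
        (Nat.lt_succ_self _) h₂
    · simp only [QRho, Sum.inr.injEq]
      apply le_antisymm
      · rw [ENNReal.tsum_eq_iSup_nat]
        exact iSup_le fun n => dagger_infinite f _ hf hr g h hg hh n x s t h₁ h₂
      · rw [ENNReal.tsum_eq_iSup_nat]
        exact iSup_le fun n => dagger_infinite _ f hf₂ (fun x => (hr x).symm) h g hh hg n x t s h₂ h₁
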